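/- Let G and G' be connected finite simple graphs whose line graphs are isomorphic. If G and G' have the same number of vertices, then G and G' are isomorphic. -/

import Mathlib

namespace SimpleGraph

variable {V V' : Type*} {G : SimpleGraph V} {G' : SimpleGraph V'}

/-- In a connected graph, a proper nonempty vertex set is left by some edge. -/
lemma Connected.exists_adj_mem_not_mem (hG : G.Connected) {s : Set V} {x y : V}
    (hx : x ∈ s) (hy : y ∉ s) : ∃ u ∈ s, ∃ w ∉ s, G.Adj u w := by
  obtain ⟨p⟩ := hG.preconnected x y
  obtain ⟨d, -, h₁, h₂⟩ := p.exists_boundary_dart s hx hy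
  exact ⟨d.fst, h₁, d.snd, h₂, d.adj⟩

/-- The edges `e` and `f` have a common endpoint (possibly `e = f`). -/
def EdgesMeet (e f : G.edgeSet) : Prop := ∃ v, v ∈ e.1 ∧ v ∈ f.1

lemma edgesMeet_iff_eq_or_adj {e f : G.edgeSet} :
    EdgesMeet e f ↔ e = f ∨ G.lineGraph.Adj e f := by
  rw [lineGraph_adj_iff_exists, EdgesMeet]
  by_cases h : e = f
  · subst h
    simpa using ⟨_, Sym2.out_fst_mem e.1⟩
  · simp [h]

lemma edgesMeet_map_iff (φ : G.lineGraph ≃g G'.lineGraph) (e f : G.edgeSet) :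
    EdgesMeet (φ e) (φ f) ↔ EdgesMeet e f := by
  simp [edgesMeet_iff_eq_or_adj, φ.map_adj_iff]

/-- Any three edges with a common endpoint are mapped to edges with a common endpoint. -/
def PreservesClaws (φ : G.lineGraph ≃g G'.lineGraph) : Prop :=
  ∀ (v : V) (e f g : G.edgeSet), e ≠ f → e ≠ g → f ≠ g → v ∈ e.1 → v ∈ f.1 → v ∈ g.1 →
    ∃ v', v' ∈ (φ e).1 ∧ v' ∈ (φ f).1 ∧ v' ∈ (φ g).1

lemma edge_eq_of_mem {e f : G.edgeSet} {u v : V} (huv : u ≠ v) (hu : u ∈ e.1) (hv : v ∈ e.1)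
    (hu' : u ∈ f.1) (hv' : v ∈ f.1) : e = f :=
  Subtype.ext (((Sym2.mem_and_mem_iff huv).1 ⟨hu, hv⟩).trans
    ((Sym2.mem_and_mem_iff huv).1 ⟨hu', hv'⟩).symm)

/-- The star of a vertex of degree at least two is mapped onto a star. -/
lemma exists_mem_iff_of_two_edges {φ : G.lineGraph ≃g G'.lineGraph} (h : PreservesClaws φ)
    (h' : PreservesClaws φ.symm) {v : V} {e f : G.edgeSet} (hef : e ≠ f) (he : v ∈ e.1)
    (hf : v ∈ f.1) : ∃ v', ∀ g, v ∈ g.1 ↔ v' ∈ (φ g).1 := by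
  obtain ⟨v', hv'e, hv'f⟩ := (edgesMeet_map_iff φ e f).2 ⟨v, he, hf⟩
  have hφ : φ e ≠ φ f := φ.injective.ne hef
  refine ⟨v', fun g => ?_⟩
  by_cases hge : g = e
  · simp [hge, he, hv'e]
  by_cases hgf : g = f
  · simp [hgf, hf, hv'f]
  constructor
  · intro hg
    obtain ⟨w, hwe, hwf, hwg⟩ := h v e f g hef (Ne.symm hge) (Ne.symm hgf) he hf hg
    by_cases hw : w = v'
    · exact hw ▸ hwg
    · exact absurd (edge_eq_of_mem hw hwe hv'e hwf hv'f) hφ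
  · intro hg
    obtain ⟨w, hwe, hwf, hwg⟩ := h' v' (φ e) (φ f) (φ g) hφ (φ.injective.ne (Ne.symm hge))
      (φ.injective.ne (Ne.symm hgf)) hv'e hv'f hg
    simp only [RelIso.symm_apply_apply] at hwe hwf hwg
    by_cases hw : w = v
    · exact hw ▸ hwg
    · exact absurd (edge_eq_of_mem hw hwe he hwf hf) hef

lemma exists_ne_ne_of_two_lt_card [Fintype V] (hV : 2 < Fintype.card V) (u v : V) :
    ∃ w, w ≠ u ∧ w ≠ v := by
  classical
  obtain ⟨w, hw⟩ := Finset.exists_mem_notMem_of_card_lt_card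
    (s := {u, v}) (t := Finset.univ) (Finset.card_le_two.trans_lt hV)
  exact ⟨w, by simpa using hw⟩

lemma Connected.exists_adj_of_two_lt_card [Fintype V] (hG : G.Connected)
    (hV : 2 < Fintype.card V) (v : V) : ∃ u, G.Adj v u := by
  obtain ⟨w, hw, -⟩ := exists_ne_ne_of_two_lt_card hV v v
  obtain ⟨x, hx, y, -, hxy⟩ := hG.exists_adj_mem_not_mem (s := {v}) rfl hw
  exact ⟨y, (show x = v from hx) ▸ hxy⟩

lemma Connected.eq_top_of_card_le_two [Fintype V] (hG : G.Connected)
    (hV : Fintype.card V ≤ 2) : G = ⊤ := by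
  classical
  ext u v
  refine ⟨Adj.ne, fun huv => ?_⟩
  obtain ⟨x, hx, y, hy, hxy⟩ := hG.exists_adj_mem_not_mem (s := {u}) rfl (Ne.symm huv)
  obtain rfl : x = u := hx
  suffices y = v from this ▸ hxy
  by_contra hyv
  have := Finset.card_le_univ {x, y, v}
  rw [Finset.card_eq_three.2 ⟨x, y, v, hxy.ne, huv, hyv, rfl⟩] at this
  omega

/-- In a connected graph on at least three vertices, every edge meets another edge. -/
lemma Connected.exists_edge_of_two_lt_card [Fintype V] (hG : G.Connected)
    (hV : 2 < Fintype.card V) {u v : V} (huv : u ≠ v) :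
    ∃ f : G.edgeSet, (u ∈ f.1 ∧ v ∉ f.1) ∨ (v ∈ f.1 ∧ u ∉ f.1) := by
  obtain ⟨w, hwu, hwv⟩ := exists_ne_ne_of_two_lt_card hV u v
  obtain ⟨x, hx, y, hy, hxy⟩ := hG.exists_adj_mem_not_mem (s := {u, v}) (x := u) (y := w)
    (by simp) (by simp [hwu, hwv])
  refine ⟨⟨s(x, y), hxy⟩, ?_⟩
  simp only [Set.mem_insert_iff, Set.mem_singleton_iff, Sym2.mem_iff] at hx hy ⊢
  grind

lemma exists_mem_iff [Fintype V] (hG : G.Connected) (hV : 2 < Fintype.card V)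
    {φ : G.lineGraph ≃g G'.lineGraph} (h : PreservesClaws φ) (h' : PreservesClaws φ.symm)
    (v : V) : ∃ v', ∀ g, v ∈ g.1 ↔ v' ∈ (φ g).1 := by
  obtain ⟨u, hvu⟩ := hG.exists_adj_of_two_lt_card hV v
  let e : G.edgeSet := ⟨s(v, u), hvu⟩
  by_cases hdeg : ∃ f, f ≠ e ∧ v ∈ f.1
  · obtain ⟨f, hfe, hf⟩ := hdeg
    exact exists_mem_iff_of_two_edges h h' hfe hf (Sym2.mem_mk_left v u)
  push Not at hdeg
  have hve : v ∈ e.1 := Sym2.mem_mk_left v u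
  have hue : u ∈ e.1 := Sym2.mem_mk_right v u
  obtain ⟨f, hf⟩ := hG.exists_edge_of_two_lt_card hV hvu.ne
  have hfe : f ≠ e := by rintro rfl; tauto
  have huf : u ∈ f.1 := by have := hdeg f hfe; tauto
  obtain ⟨u', hu'⟩ := exists_mem_iff_of_two_edges h h' hfe huf hue
  obtain ⟨w, hw⟩ := (hu' e).1 hue
  have hwe : w ∈ (φ e).1 := hw ▸ Sym2.mem_mk_right u' w
  have hu'w : u' ≠ w := by
    have := (φ e).2
    rw [hw] at this
    exact Adj.ne this
  refine ⟨w, fun g => ⟨fun hg => ?_, fun hg => ?_⟩⟩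
  · by_cases hge : g = e
    · exact hge ▸ hwe
    · exact absurd hg (hdeg g hge)
  · by_cases hge : g = e
    · exact hge ▸ hve
    obtain ⟨x, hx⟩ := exists_mem_iff_of_two_edges (φ := φ.symm) h' (by simpa using h)
      (φ.injective.ne hge) hg hwe
    have hx' (k : G.edgeSet) : w ∈ (φ k).1 ↔ x ∈ k.1 := by simpa using hx (φ k)
    rcases Sym2.mem_iff.1 ((hx' e).1 hwe) with rfl | rfl
    · exact (hx' g).1 hg
    · exact absurd (φ.injective (edge_eq_of_mem hu'w ((hu' f).1 huf) ((hx' f).2 huf)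
        ((hu' e).1 hue) hwe)) hfe

/-- A line graph isomorphism preserving claws in both directions is induced by a graph
isomorphism. -/
lemma nonempty_iso_of_preservesClaws [Fintype V] [Fintype V'] (hG : G.Connected)
    (hcard : Fintype.card V = Fintype.card V') (hV : 2 < Fintype.card V)
    {φ : G.lineGraph ≃g G'.lineGraph} (h : PreservesClaws φ) (h' : PreservesClaws φ.symm) :
    Nonempty (G ≃g G') := by
  choose ρ hρ using exists_mem_iff hG hV h h'
  have hinj : Function.Injective ρ := by
    intro u v huv
    by_contra hne
    obtain ⟨f, hf⟩ := hG.exists_edge_of_two_lt_card hV hne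
    simp only [hρ, huv] at hf
    tauto
  have hbij := (Fintype.bijective_iff_injective_and_card ρ).2 ⟨hinj, hcard⟩
  refine ⟨⟨Equiv.ofBijective ρ hbij, fun {u v} => ?_⟩⟩
  simp only [Equiv.ofBijective_apply]
  constructor
  · intro huv
    obtain ⟨g, hg⟩ := φ.surjective ⟨s(ρ u, ρ v), huv⟩
    have hne : u ≠ v := fun hne => huv.ne (congrArg ρ hne)
    have hu : u ∈ g.1 := (hρ u g).2 (by simp [hg])
    have hv : v ∈ g.1 := (hρ v g).2 (by simp [hg])
    have := g.2
    rwa [(Sym2.mem_and_mem_iff hne).1 ⟨hu, hv⟩] at this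
  · intro huv
    have := (φ ⟨s(u, v), huv⟩).2
    rwa [(Sym2.mem_and_mem_iff (hinj.ne huv.ne)).1
      ⟨(hρ u _).1 (by simp), (hρ v _).1 (by simp)⟩] at this

/-- Three pairwise meeting edges without a common endpoint form a triangle. -/
lemma exists_triangle {e f g : G.edgeSet} (hef : EdgesMeet e f) (heg : EdgesMeet e g)
    (hfg : EdgesMeet f g) (h : ¬ ∃ v, v ∈ e.1 ∧ v ∈ f.1 ∧ v ∈ g.1) :
    ∃ a b c, e.1 = s(b, c) ∧ f.1 = s(a, c) ∧ g.1 = s(a, b) := by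
  obtain ⟨c, hce, hcf⟩ := hef
  obtain ⟨b, hbe, hbg⟩ := heg
  obtain ⟨a, haf, hag⟩ := hfg
  have hab : a ≠ b := by rintro rfl; exact h ⟨_, hbe, haf, hag⟩
  have hac : a ≠ c := by rintro rfl; exact h ⟨_, hce, haf, hag⟩
  have hbc : b ≠ c := by rintro rfl; exact h ⟨_, hce, hcf, hbg⟩
  exact ⟨a, b, c, (Sym2.mem_and_mem_iff hbc).1 ⟨hbe, hce⟩, (Sym2.mem_and_mem_iff hac).1 ⟨haf, hcf⟩,
    (Sym2.mem_and_mem_iff hab).1 ⟨hag, hbg⟩⟩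

lemma nonempty_iso_of_four {a b c d : V} {a' b' c' d' : V'}
    (hab : a ≠ b) (hac : a ≠ c) (had : a ≠ d) (hbc : b ≠ c) (hbd : b ≠ d) (hcd : c ≠ d)
    (hV : ∀ x, x = a ∨ x = b ∨ x = c ∨ x = d)
    (hab' : a' ≠ b') (hac' : a' ≠ c') (had' : a' ≠ d') (hbc' : b' ≠ c') (hbd' : b' ≠ d')
    (hcd' : c' ≠ d') (hV' : ∀ x, x = a' ∨ x = b' ∨ x = c' ∨ x = d')
    (iab : G.Adj a b ↔ G'.Adj a' b') (iac : G.Adj a c ↔ G'.Adj a' c')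
    (iad : G.Adj a d ↔ G'.Adj a' d') (ibc : G.Adj b c ↔ G'.Adj b' c')
    (ibd : G.Adj b d ↔ G'.Adj b' d') (icd : G.Adj c d ↔ G'.Adj c' d') :
    Nonempty (G ≃g G') := by
  classical
  have flip {x y : V} {x' y' : V'} (h : G.Adj x y ↔ G'.Adj x' y') : G.Adj y x ↔ G'.Adj y' x' := by
    rw [G.adj_comm, h, G'.adj_comm]
  have iba := flip iab
  have ica := flip iac
  have ida := flip iad
  have icb := flip ibc
  have idb := flip ibd
  have idc := flip icd
  clear flip
  let ρ : V → V' := fun x => if x = a then a' else if x = b then b' else if x = c then c' else d'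
  have ha : ρ a = a' := by simp [ρ]
  have hb : ρ b = b' := by simp [ρ, hab.symm]
  have hc : ρ c = c' := by simp [ρ, hac.symm, hbc.symm]
  have hd : ρ d = d' := by simp [ρ, had.symm, hbd.symm, hcd.symm]
  clear_value ρ
  have hρ : Function.Bijective ρ := by
    constructor
    · intro x y hxy
      rcases hV x with rfl | rfl | rfl | rfl <;> rcases hV y with rfl | rfl | rfl | rfl <;>
        first | rfl | (simp only [ha, hb, hc, hd] at hxy; subst hxy; contradiction)
    · intro y
      rcases hV' y with rfl | rfl | rfl | rfl
      exacts [⟨a, ha⟩, ⟨b, hb⟩, ⟨c, hc⟩, ⟨d, hd⟩]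
  refine ⟨⟨Equiv.ofBijective ρ hρ, fun {x y} => ?_⟩⟩
  simp only [Equiv.ofBijective_apply]
  rcases hV x with rfl | rfl | rfl | rfl <;> rcases hV y with rfl | rfl | rfl | rfl <;>
    simp only [ha, hb, hc, hd, SimpleGraph.irrefl, iab, iac, iad, ibc, ibd, icd, iba, ica, ida, icb,
      idb, idc]

/-- Four-vertex graphs `G`, with `v` adjacent to `a, b, c`, and `G'`, with a triangle `a'b'c'`, are
isomorphic if the edges of `G` within `abc` match the edges of `G'` at `d'`. -/
lemma nonempty_iso_of_claw_of_triangle {v a b c : V} {d' a' b' c' : V'}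
    (hva : G.Adj v a) (hvb : G.Adj v b) (hvc : G.Adj v c)
    (hab : a ≠ b) (hac : a ≠ c) (hbc : b ≠ c) (hV : ∀ x, x = v ∨ x = a ∨ x = b ∨ x = c)
    (hab' : G'.Adj a' b') (hac' : G'.Adj a' c') (hbc' : G'.Adj b' c')
    (hda' : d' ≠ a') (hdb' : d' ≠ b') (hdc' : d' ≠ c')
    (hV' : ∀ x, x = d' ∨ x = a' ∨ x = b' ∨ x = c')
    (iab : G.Adj a b ↔ G'.Adj d' c') (iac : G.Adj a c ↔ G'.Adj d' b')
    (ibc : G.Adj b c ↔ G'.Adj d' a') (hd : G'.Adj d' a' ∨ G'.Adj d' b' ∨ G'.Adj d' c') :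
    Nonempty (G ≃g G') := by
  have iso {p q r s : V'} (hpq : p ≠ q) (hpr : p ≠ r) (hps : p ≠ s) (hqr : q ≠ r) (hqs : q ≠ s)
      (hrs : r ≠ s) (h : ∀ x, x = p ∨ x = q ∨ x = r ∨ x = s) (apq : G'.Adj p q)
      (apr : G'.Adj p r) (aps : G'.Adj p s) (aqr : G.Adj a b ↔ G'.Adj q r)
      (aqs : G.Adj a c ↔ G'.Adj q s) (ars : G.Adj b c ↔ G'.Adj r s) : Nonempty (G ≃g G') :=
    nonempty_iso_of_four hva.ne hvb.ne hvc.ne hab hac hbc hV hpq hpr hps hqr hqs hrs h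
      (iff_of_true hva apq) (iff_of_true hvb apr) (iff_of_true hvc aps) aqr aqs ars
  clear hV
  have sab := G'.adj_comm a' b'
  have sac := G'.adj_comm a' c'
  have sbc := G'.adj_comm b' c'
  have sda := G'.adj_comm d' a'
  have sdb := G'.adj_comm d' b'
  have sdc := G'.adj_comm d' c'
  have nab := hab'.ne
  have nac := hac'.ne
  have nbc := hbc'.ne
  by_cases ha : G'.Adj d' a' <;> by_cases hb : G'.Adj d' b' <;> by_cases hc : G'.Adj d' c'
  · refine iso (p := d') (q := a') (r := b') (s := c') ?_ ?_ ?_ ?_ ?_ ?_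
      (fun x => by have := hV' x; clear iso; grind) ?_ ?_ ?_ ?_ ?_ ?_ <;> clear iso <;> grind
  · refine iso (p := a') (q := c') (r := d') (s := b') ?_ ?_ ?_ ?_ ?_ ?_
      (fun x => by have := hV' x; clear iso; grind) ?_ ?_ ?_ ?_ ?_ ?_ <;> clear iso <;> grind
  · refine iso (p := a') (q := d') (r := c') (s := b') ?_ ?_ ?_ ?_ ?_ ?_
      (fun x => by have := hV' x; clear iso; grind) ?_ ?_ ?_ ?_ ?_ ?_ <;> clear iso <;> grind
  · refine iso (p := a') (q := d') (r := b') (s := c') ?_ ?_ ?_ ?_ ?_ ?_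
      (fun x => by have := hV' x; clear iso; grind) ?_ ?_ ?_ ?_ ?_ ?_ <;> clear iso <;> grind
  · refine iso (p := b') (q := c') (r := a') (s := d') ?_ ?_ ?_ ?_ ?_ ?_
      (fun x => by have := hV' x; clear iso; grind) ?_ ?_ ?_ ?_ ?_ ?_ <;> clear iso <;> grind
  · refine iso (p := b') (q := a') (r := d') (s := c') ?_ ?_ ?_ ?_ ?_ ?_
      (fun x => by have := hV' x; clear iso; grind) ?_ ?_ ?_ ?_ ?_ ?_ <;> clear iso <;> grind
  · refine iso (p := c') (q := a') (r := b') (s := d') ?_ ?_ ?_ ?_ ?_ ?_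
      (fun x => by have := hV' x; clear iso; grind) ?_ ?_ ?_ ?_ ?_ ?_ <;> clear iso <;> grind
  · simp [ha, hb, hc] at hd

/-- If the claw `va, vb, vc` is mapped to the triangle `b'c', a'c', a'b'`, then any further edge
avoids `v`, its image has at most one endpoint on the triangle, and incidences correspond. -/
lemma mem_iff_of_claw_to_triangle {φ : G.lineGraph ≃g G'.lineGraph} {v a b c : V}
    {a' b' c' : V'} {A B C k : G.edgeSet} (hA : A.1 = s(v, a)) (hB : B.1 = s(v, b))
    (hC : C.1 = s(v, c)) (hA' : (φ A).1 = s(b', c')) (hB' : (φ B).1 = s(a', c'))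
    (hC' : (φ C).1 = s(a', b')) (hkA : k ≠ A) (hkB : k ≠ B) (hkC : k ≠ C) :
    v ∉ k.1 ∧ (a ∈ k.1 ↔ b' ∈ (φ k).1 ∨ c' ∈ (φ k).1) ∧
      (b ∈ k.1 ↔ a' ∈ (φ k).1 ∨ c' ∈ (φ k).1) ∧ (c ∈ k.1 ↔ a' ∈ (φ k).1 ∨ b' ∈ (φ k).1) ∧
      ¬ (b' ∈ (φ k).1 ∧ c' ∈ (φ k).1) ∧ ¬ (a' ∈ (φ k).1 ∧ c' ∈ (φ k).1) ∧
      ¬ (a' ∈ (φ k).1 ∧ b' ∈ (φ k).1) := by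
  have meets {e : G.edgeSet} {x : V} {y z : V'} (he : e.1 = s(v, x)) (he' : (φ e).1 = s(y, z)) :
      y ∈ (φ k).1 ∨ z ∈ (φ k).1 ↔ v ∈ k.1 ∨ x ∈ k.1 := by
    simpa [EdgesMeet, he, he'] using edgesMeet_map_iff φ e k
  have not_both {e : G.edgeSet} {y z : V'} (he' : (φ e).1 = s(y, z)) (hke : k ≠ e) :
      ¬ (y ∈ (φ k).1 ∧ z ∈ (φ k).1) := by
    have hyz : y ≠ z := by
      have := (φ e).2
      rw [he'] at this
      exact Adj.ne this
    exact fun h => hke (φ.injective (edge_eq_of_mem hyz h.1 h.2 (by simp [he']) (by simp [he'])))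
  have mA := meets hA hA'
  have mB := meets hB hB'
  have mC := meets hC hC'
  have nA := not_both hA' hkA
  have nB := not_both hB' hkB
  have nC := not_both hC' hkC
  grind

/-- If a line graph isomorphism between connected graphs of equal order maps a claw to a triangle,
then the graphs are isomorphic (and have four vertices). -/
lemma nonempty_iso_of_not_preservesClaws [Fintype V] [Fintype V'] (hG : G.Connected)
    (hG' : G'.Connected) (hcard : Fintype.card V = Fintype.card V')
    {φ : G.lineGraph ≃g G'.lineGraph} (h : ¬ PreservesClaws φ) : Nonempty (G ≃g G') := by
  classical
  simp only [PreservesClaws, not_forall] at h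
  obtain ⟨v, A, B, C, hAB, hAC, hBC, hvA, hvB, hvC, hno⟩ := h
  obtain ⟨a', b', c', hA', hB', hC'⟩ := exists_triangle ((edgesMeet_map_iff φ A B).2 ⟨v, hvA, hvB⟩)
    ((edgesMeet_map_iff φ A C).2 ⟨v, hvA, hvC⟩) ((edgesMeet_map_iff φ B C).2 ⟨v, hvB, hvC⟩) hno
  obtain ⟨a, hA⟩ := hvA
  obtain ⟨b, hB⟩ := hvB
  obtain ⟨c, hC⟩ := hvC
  have hab : a ≠ b := by rintro rfl; exact hAB (Subtype.ext (hA.trans hB.symm))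
  have hac : a ≠ c := by rintro rfl; exact hAC (Subtype.ext (hA.trans hC.symm))
  have hbc : b ≠ c := by rintro rfl; exact hBC (Subtype.ext (hB.trans hC.symm))
  have adj {x y : V} {e : G.edgeSet} (he : e.1 = s(x, y)) : G.Adj x y := by
    have := e.2
    rwa [he] at this
  have adj' {x y : V'} {e : G'.edgeSet} (he : e.1 = s(x, y)) : G'.Adj x y := by
    have := e.2
    rwa [he] at this
  have hva := adj hA
  have hvb := adj hB
  have hvc := adj hC
  have hbc' := adj' hA'
  have hac' := adj' hB'
  have hab' := adj' hC'
  have key {k : G.edgeSet} := mem_iff_of_claw_to_triangle (k := k) hA hB hC hA' hB' hC'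
  have ne_claw {k e : G.edgeSet} {x y : V} (he : e.1 = s(v, x)) (hy : y ∈ k.1) (hyv : y ≠ v)
      (hyx : y ≠ x) : k ≠ e := by
    rintro rfl
    simp [he, hyv, hyx] at hy
  have hV (x : V) : x = v ∨ x = a ∨ x = b ∨ x = c := by
    by_contra hx
    obtain ⟨p, hp, q, hq, hpq⟩ := hG.exists_adj_mem_not_mem (s := {v, a, b, c}) (x := v) (y := x)
      (by simp) (by simpa using hx)
    simp only [Set.mem_insert_iff, Set.mem_singleton_iff, not_or] at hp hq
    obtain ⟨hqv, hqa, hqb, hqc⟩ := hq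
    have hqk : q ∈ s(p, q) := Sym2.mem_mk_right p q
    have hk := key (k := ⟨s(p, q), hpq⟩) (ne_claw hA hqk hqv hqa) (ne_claw hB hqk hqv hqb)
      (ne_claw hC hqk hqv hqc)
    have mem (y : V) (hy : q ≠ y) : y ∈ s(p, q) ↔ y = p := by simp [hy.symm]
    simp only [mem v hqv, mem a hqa, mem b hqb, mem c hqc] at hk
    rcases hp with rfl | rfl | rfl | rfl <;> grind
  have card4 : Fintype.card V = 4 := by
    rw [← Finset.card_univ, show (Finset.univ : Finset V) = {v, a, b, c} by ext x; simpa using hV x]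
    simp [hab, hac, hbc, hva.ne, hvb.ne, hvc.ne]
  obtain ⟨d', -, hd'⟩ := Finset.exists_mem_notMem_of_card_lt_card
    (s := {a', b', c'}) (t := (Finset.univ : Finset V'))
    (Finset.card_le_three.trans_lt (by rw [Finset.card_univ, ← hcard, card4]; norm_num))
  simp only [Finset.mem_insert, Finset.mem_singleton, not_or] at hd'
  obtain ⟨hda', hdb', hdc'⟩ := hd'
  have hV' (x : V') : x = d' ∨ x = a' ∨ x = b' ∨ x = c' := by
    have huniv := Finset.eq_univ_of_card ({d', a', b', c'} : Finset V')
      (by simp [hda', hdb', hdc', hab'.ne, hac'.ne, hbc'.ne, ← hcard, card4])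
    simpa [← huniv] using Finset.mem_univ x
  have adj_d' {e : G'.edgeSet} {x y z : V'} (hxyz : ∀ w, w = d' ∨ w = x ∨ w = y ∨ w = z)
      (hx : x ∈ e.1) (hy : y ∉ e.1) (hz : z ∉ e.1) : G'.Adj d' x := by
    obtain ⟨w, hw⟩ := hx
    have hxw := adj' hw
    rcases hxyz w with rfl | rfl | rfl | rfl
    · exact hxw.symm
    · exact absurd hxw G'.irrefl
    · simp [hw] at hy
    · simp [hw] at hz
  have ne_triangle {k e : G.edgeSet} {x y : V'} (he : (φ e).1 = s(x, y)) (hd : d' ∈ (φ k).1)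
      (hx : d' ≠ x) (hy : d' ≠ y) : k ≠ e := by
    rintro rfl
    simp [he, hx, hy] at hd
  have key' {x : V'} (hx : G'.Adj d' x) : ∃ k : G.edgeSet, x ∈ (φ k).1 ∧ k ≠ A ∧ k ≠ B ∧ k ≠ C := by
    obtain ⟨k, hk⟩ := φ.surjective ⟨s(d', x), hx⟩
    have hd : d' ∈ (φ k).1 := by simp [hk]
    exact ⟨k, by simp [hk], ne_triangle hA' hd hdb' hdc', ne_triangle hB' hd hda' hdc',
      ne_triangle hC' hd hda' hdb'⟩
  have iab : G.Adj a b ↔ G'.Adj d' c' := by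
    constructor
    · intro h
      have ha : a ∈ s(a, b) := Sym2.mem_mk_left a b
      have hb : b ∈ s(a, b) := Sym2.mem_mk_right a b
      have hc : c ∉ s(a, b) := by simp [hac.symm, hbc.symm]
      have hk := key (k := ⟨s(a, b), h⟩) (ne_claw hA hb hvb.ne' hab.symm)
        (ne_claw hB ha hva.ne' hab) (ne_claw hC ha hva.ne' hac)
      exact adj_d' (e := φ ⟨s(a, b), h⟩) (x := c') (y := a') (z := b')
        (fun w => by have := hV' w; clear * - this; tauto) (by grind) (by grind) (by grind)
    · intro h
      obtain ⟨k, hk, hkA, hkB, hkC⟩ := key' h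
      have := key hkA hkB hkC
      exact adj (e := k) ((Sym2.mem_and_mem_iff hab).1 (by grind))
  have ibc : G.Adj b c ↔ G'.Adj d' a' := by
    constructor
    · intro h
      have hb : b ∈ s(b, c) := Sym2.mem_mk_left b c
      have hc : c ∈ s(b, c) := Sym2.mem_mk_right b c
      have ha : a ∉ s(b, c) := by simp [hab, hac]
      have hk := key (k := ⟨s(b, c), h⟩) (ne_claw hA hb hvb.ne' hab.symm)
        (ne_claw hB hc hvc.ne' hbc.symm) (ne_claw hC hb hvb.ne' hbc)
      exact adj_d' (e := φ ⟨s(b, c), h⟩) (x := a') (y := b') (z := c')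
        (fun w => by have := hV' w; clear * - this; tauto) (by grind) (by grind) (by grind)
    · intro h
      obtain ⟨k, hk, hkA, hkB, hkC⟩ := key' h
      have := key hkA hkB hkC
      exact adj (e := k) ((Sym2.mem_and_mem_iff hbc).1 (by grind))
  have iac : G.Adj a c ↔ G'.Adj d' b' := by
    constructor
    · intro h
      have ha : a ∈ s(a, c) := Sym2.mem_mk_left a c
      have hc : c ∈ s(a, c) := Sym2.mem_mk_right a c
      have hb : b ∉ s(a, c) := by simp [hab.symm, hbc]
      have hk := key (k := ⟨s(a, c), h⟩) (ne_claw hA hc hvc.ne' hac.symm)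
        (ne_claw hB ha hva.ne' hab) (ne_claw hC ha hva.ne' hac)
      exact adj_d' (e := φ ⟨s(a, c), h⟩) (x := b') (y := a') (z := c')
        (fun w => by have := hV' w; clear * - this; tauto) (by grind) (by grind) (by grind)
    · intro h
      obtain ⟨k, hk, hkA, hkB, hkC⟩ := key' h
      have := key hkA hkB hkC
      exact adj (e := k) ((Sym2.mem_and_mem_iff hac).1 (by grind))
  obtain ⟨w, hw⟩ := hG'.exists_adj_of_two_lt_card (by omega) d'
  have hd : G'.Adj d' a' ∨ G'.Adj d' b' ∨ G'.Adj d' c' := by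
    rcases hV' w with rfl | rfl | rfl | rfl
    · exact absurd hw G'.irrefl
    all_goals grind
  exact nonempty_iso_of_claw_of_triangle hva hvb hvc hab hac hbc hV hab' hac' hbc' hda' hdb' hdc'
    hV' iab iac ibc hd

end SimpleGraph

open SimpleGraph in
/-- Whitney's theorem with the exceptional pair excluded via vertex counts:
connected finite simple graphs with isomorphic line graphs and the same number of
vertices are isomorphic. -/
theorem whitney_line_graph {V V' : Type*} [Fintype V] [Fintype V']
    (G : SimpleGraph V) (G' : SimpleGraph V')
    (hG : G.Connected) (hG' : G'.Connected)
    (hiso : Nonempty (G.lineGraph ≃g G'.lineGraph))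
    (hcard : Fintype.card V = Fintype.card V') :
    Nonempty (G ≃g G') := by
  obtain ⟨φ⟩ := hiso
  by_cases hV : 2 < Fintype.card V
  · by_cases h : PreservesClaws φ
    · by_cases h' : PreservesClaws φ.symm
      · exact nonempty_iso_of_preservesClaws hG hcard hV h h'
      · exact (nonempty_iso_of_not_preservesClaws hG' hG hcard.symm h').map Iso.symm
    · exact nonempty_iso_of_not_preservesClaws hG hG' hcard h
  · rw [hG.eq_top_of_card_le_two (by omega), hG'.eq_top_of_card_le_two (by omega)]
    exact ⟨Iso.completeGraph (Fintype.equivOfCardEq hcard)⟩
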